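/- Let A be a finite-dimensional unital associative algebra over an algebraically closed field of characteristic p with p ≠ 2 and p ≠ 3, let L = A^(k) for some k ≥ 0, and let B be a Jordan-Lie inner ideal of L. Then B is bar-minimal if and only if B = eAf for some strict orthogonal idempotent pair (e,f) in A. -/

import Mathlib

namespace Paper

variable (F A : Type*) [Field F] [Ring A] [Algebra F A]

/-- The derived series `A⁽ᵏ⁾` of the Lie algebra `A⁽⁻⁾` (as subspaces of `A`). -/
def derivedSeries : ℕ → Submodule F A
  | 0 => ⊤
  | (k+1) => Submodule.span F
      {z : A | ∃ x ∈ derivedSeries k, ∃ y ∈ derivedSeries k, z = ⁅x, y⁆}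

variable {F A}

/-- `B` is an inner ideal of the Lie algebra given by the subspace `L` of `A⁽⁻⁾`. -/
def IsInnerIdeal (L B : Submodule F A) : Prop :=
  B ≤ L ∧ ∀ b ∈ B, ∀ b' ∈ B, ∀ x ∈ L, ⁅b, ⁅b', x⁆⁆ ∈ B

/-- `B` is a Jordan-Lie inner ideal of `L`. -/
def IsJordanLie (L B : Submodule F A) : Prop :=
  IsInnerIdeal L B ∧ ∀ b ∈ B, ∀ b' ∈ B, b * b' = 0

/-- Jacobson radical of `A` as an `F`-subspace. -/
noncomputable def radical : Submodule F A :=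
  (Ideal.jacobson (⊥ : Ideal A)).restrictScalars F

/-- The Jacobson radical of a subalgebra `A'`, as a subset of `A`. -/
def subalgRad (A' : Subalgebra F A) : Set A :=
  Subtype.val '' ((Ideal.jacobson (⊥ : Ideal A')) : Set A')

/-- `c` represents a central idempotent of the quotient of the
(sub)algebra with carrier `S` by the ideal with carrier `ρ`. -/
def IsCentralIdempotentMod (S ρ : Set A) (c : A) : Prop :=
  c ∈ S ∧ (∀ a ∈ S, c * a - a * c ∈ ρ) ∧ c * c - c ∈ ρ

/-- `c` represents a primitive central idempotent of the quotient mod `ρ`. -/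
def IsPrimitiveCentralIdempotentMod (S ρ : Set A) (c : A) : Prop :=
  IsCentralIdempotentMod S ρ c ∧ c ∉ ρ ∧
    ¬ ∃ c₁ c₂ : A, IsCentralIdempotentMod S ρ c₁ ∧ IsCentralIdempotentMod S ρ c₂ ∧
      c₁ ∉ ρ ∧ c₂ ∉ ρ ∧ c₁ * c₂ ∈ ρ ∧ c₂ * c₁ ∈ ρ ∧ c - (c₁ + c₂) ∈ ρ

/-- The idempotent pair `(e, f)` is strict w.r.t. the quotient mod `ρ`:
for every primitive central idempotent `c` of the quotient, `c·ē = 0 ↔ c·f̄ = 0`. -/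
def IsStrictPairMod (S ρ : Set A) (e f : A) : Prop :=
  ∀ c : A, IsPrimitiveCentralIdempotentMod S ρ c → (c * e ∈ ρ ↔ c * f ∈ ρ)

/-- `(e,f)` is a strict idempotent pair of `A` (strictness w.r.t. `A/rad A`). -/
def IsStrictPair (e f : A) : Prop :=
  e * e = e ∧ f * f = f ∧
    IsStrictPairMod Set.univ ((Ideal.jacobson (⊥ : Ideal A)) : Set A) e f

/-- `J` is a two-sided ideal of the (possibly non-unital) algebra `P`. -/
def IsTwoSidedIdealIn (P J : Submodule F A) : Prop :=
  J ≤ P ∧ ∀ p ∈ P, ∀ x ∈ J, p * x ∈ J ∧ x * p ∈ J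

/-- The algebra with carrier `P` is 1-perfect: it has no two-sided ideals of
codimension 1. -/
def IsOnePerfect (P : Submodule F A) : Prop :=
  ¬ ∃ J : Submodule F A, IsTwoSidedIdealIn P J ∧
      Module.finrank F P = Module.finrank F J + 1



section Ring

variable {A : Type*} [Ring A]

/-- If `a² - a` is nilpotent, then some idempotent in `aA ∩ Aa` is congruent to `a` modulo `a² - a`. -/
theorem exists_idempotent_of_nilpotent (n : ℕ) (a : A) (h : (a * a - a) ^ 2 ^ n = 0) :
    ∃ x y z : A, (a * x) * (a * x) = a * x ∧ a * x = y * a ∧ a * x - a = (a * a - a) * z := by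
  induction n generalizing a with
  | zero =>
    have h' : a * a = a := by simpa [sub_eq_zero] using h
    exact ⟨1, 1, 0, by simp [h']⟩
  | succ n ih =>
    obtain ⟨x, y, z, h1, h2, h3⟩ := ih (a * (3 * a - 2 * (a * a))) (by
      have h4 : a * (3 * a - 2 * (a * a)) * (a * (3 * a - 2 * (a * a))) -
          a * (3 * a - 2 * (a * a)) = (a * a - a) ^ 2 * (4 * (a * a - a) - 3) := by
        noncomm_ring
      have h5 : Commute ((a * a - a) ^ 2) (4 * (a * a - a) - 3) := by
        rw [Commute, SemiconjBy]
        noncomm_ring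
      rw [h4, h5.mul_pow, ← pow_mul, ← pow_succ', h, zero_mul])
    refine ⟨(3 * a - 2 * (a * a)) * x, y * (3 * a - 2 * (a * a)),
      (1 - 2 * a) + (a * a - a) * (4 * (a * a - a) - 3) * z, ?_, ?_, ?_⟩
    · simpa only [mul_assoc] using h1
    · rw [← mul_assoc, h2]
      noncomm_ring
    · have h4 : a * (3 * a - 2 * (a * a)) * (a * (3 * a - 2 * (a * a))) -
          a * (3 * a - 2 * (a * a)) = (a * a - a) * ((a * a - a) * (4 * (a * a - a) - 3)) := by
        noncomm_ring
      rw [h4] at h3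
      rw [← mul_assoc, ← sub_add_sub_cancel _ (a * (3 * a - 2 * (a * a))) a, h3]
      noncomm_ring

theorem left_orthogonalize {b v : A} (hb : b * b = 0) (hv : v * b * v = v) :
    ((1 - b * v) * v) * b * ((1 - b * v) * v) = (1 - b * v) * v ∧
      ((1 - b * v) * v) * ((1 - b * v) * v) = 0 ∧ b * ((1 - b * v) * v) = b * v := by
  have h1 : b * ((1 - b * v) * v) = b * v := by
    linear_combination (norm := noncomm_ring) - hb * (v * v)
  refine ⟨?_, ?_, h1⟩
  · rw [mul_assoc, h1]
    linear_combination (norm := noncomm_ring) (1 - b * v) * hv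
  · linear_combination (norm := noncomm_ring) -(1 - b * v) * hv * v

theorem right_orthogonalize {b v : A} (hb : b * b = 0) (hv : v * b * v = v) :
    (v * (1 - v * b)) * b * (v * (1 - v * b)) = v * (1 - v * b) ∧
      (v * (1 - v * b)) * (v * (1 - v * b)) = 0 ∧ (v * (1 - v * b)) * b = v * b := by
  have h1 : (v * (1 - v * b)) * b = v * b := by
    linear_combination (norm := noncomm_ring) - (v * v) * hb
  refine ⟨?_, ?_, h1⟩
  · rw [h1]
    linear_combination (norm := noncomm_ring) hv * (1 - v * b)
  · linear_combination (norm := noncomm_ring) -v * hv * (1 - v * b)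

/-- The quotient map modulo the Jacobson radical. -/
abbrev toSemisimple (A : Type*) [Ring A] : A →+* A ⧸ Ideal.jacobson (⊥ : Ideal A) :=
  Ideal.Quotient.mk _

theorem toSemisimple_eq_zero_iff {a : A} :
    toSemisimple A a = 0 ↔ a ∈ Ideal.jacobson (⊥ : Ideal A) :=
  Ideal.Quotient.eq_zero_iff_mem

theorem toSemisimple_mul_eq_zero {u e l : A}
    (hu : ∀ a, toSemisimple A (u * a) = toSemisimple A (a * u))
    (h : toSemisimple A (u * e) = 0) (a b : A) (hl : l = a * e * b) :
    toSemisimple A (u * l) = 0 := by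
  rw [hl, ← mul_assoc, ← mul_assoc, map_mul, map_mul, hu, ← map_mul, mul_assoc a u e, map_mul, h,
    mul_zero, zero_mul]

variable [IsArtinianRing A]

theorem exists_pow_eq_zero_of_toSemisimple_eq_zero {a : A} (h : toSemisimple A a = 0) :
    ∃ n : ℕ, a ^ n = 0 := by
  obtain ⟨n, hn⟩ := IsArtinianRing.isNilpotent_jacobson_bot (R := A)
  refine ⟨n, ?_⟩
  have := Ideal.pow_mem_pow (toSemisimple_eq_zero_iff.1 h) n
  rw [hn] at this
  simpa using this

theorem isSemisimpleRing_quotient : IsSemisimpleRing (A ⧸ Ideal.jacobson (⊥ : Ideal A)) := by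
  suffices ∀ (I : Ideal A) [I.IsTwoSided], I = Ring.jacobson A → IsSemisimpleRing (A ⧸ I) from
    this _ Ideal.jacobson_bot
  rintro _ _ rfl
  infer_instance

theorem eq_zero_of_idempotent {a : A} (h : a * a = a) (h0 : toSemisimple A a = 0) : a = 0 := by
  obtain ⟨n, hn⟩ := exists_pow_eq_zero_of_toSemisimple_eq_zero h0
  have : IsIdempotentElem a := h
  rcases n with _ | n
  · have : (1 : A) = 0 := by simpa using hn
    rw [← one_mul a, this, zero_mul]
  · rwa [this.pow_succ_eq] at hn

theorem exists_idempotent_lift {a : A}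
    (h : toSemisimple A a * toSemisimple A a = toSemisimple A a) :
    ∃ g x y : A, g * g = g ∧ g = a * x ∧ g = y * a ∧ toSemisimple A g = toSemisimple A a := by
  have h0 : toSemisimple A (a * a - a) = 0 := by simp [h]
  obtain ⟨n, hn⟩ := exists_pow_eq_zero_of_toSemisimple_eq_zero h0
  obtain ⟨x, y, z, h1, h2, h3⟩ := exists_idempotent_of_nilpotent n a
    (pow_eq_zero_of_le Nat.lt_two_pow_self.le hn)
  refine ⟨a * x, x, y, h1, rfl, h2, ?_⟩
  rw [← sub_eq_zero, ← map_sub, h3, map_mul, h0, zero_mul]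

/-- Modulo the radical, a left ideal is generated by an idempotent that it contains. -/
theorem exists_idempotent_left (Λ : AddSubgroup A) (h : ∀ a, ∀ l ∈ Λ, a * l ∈ Λ) :
    ∃ g ∈ Λ, g * g = g ∧
      ∀ l ∈ Λ, toSemisimple A (l * g) = toSemisimple A l := by
  have := isSemisimpleRing_quotient (A := A)
  let I : Ideal A := { Λ with smul_mem' := fun a l hl => h a l hl }
  obtain ⟨e, he, hI⟩ := IsSemisimpleRing.ideal_eq_span_idempotent (I.map (toSemisimple A))
  have hmem : e ∈ I.map (toSemisimple A) := by
    rw [hI]; exact Ideal.mem_span_singleton_self e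
  obtain ⟨a, ha, rfl⟩ := (Ideal.mem_map_iff_of_surjective _ Ideal.Quotient.mk_surjective).1 hmem
  obtain ⟨g, x, y, h1, h2, h3, h4⟩ := exists_idempotent_lift he
  refine ⟨g, h3 ▸ h y a ha, h1, fun l hl => ?_⟩
  have hl' : toSemisimple A l ∈ I.map (toSemisimple A) := Ideal.mem_map_of_mem _ hl
  rw [hI, Ideal.mem_span_singleton'] at hl'
  obtain ⟨b, hb⟩ := hl'
  rw [map_mul, ← hb, h4, mul_assoc, he]

/-- Modulo the radical, a right ideal is generated by an idempotent that it contains. -/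
theorem exists_idempotent_right (Λ : AddSubgroup A) (h : ∀ a, ∀ l ∈ Λ, l * a ∈ Λ) :
    ∃ g ∈ Λ, g * g = g ∧
      ∀ l ∈ Λ, toSemisimple A (g * l) = toSemisimple A l := by
  have := isSemisimpleRing_quotient (A := A)
  let Q := A ⧸ Ideal.jacobson (⊥ : Ideal A)
  let I : Ideal Qᵐᵒᵖ :=
    { carrier := {q | ∃ l ∈ Λ, toSemisimple A l = q.unop}
      add_mem' := by
        rintro _ _ ⟨l, hl, h1⟩ ⟨m, hm, h2⟩
        exact ⟨l + m, Λ.add_mem hl hm, by simp [h1, h2]⟩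
      zero_mem' := ⟨0, Λ.zero_mem, by simp⟩
      smul_mem' := by
        rintro c _ ⟨l, hl, h1⟩
        obtain ⟨a, ha⟩ := Ideal.Quotient.mk_surjective c.unop
        exact ⟨l * a, h a l hl, by simp [h1, ha]⟩ }
  obtain ⟨e, he, hI⟩ := IsSemisimpleRing.ideal_eq_span_idempotent I
  have hmem : e ∈ I := by
    rw [hI]; exact Ideal.mem_span_singleton_self e
  obtain ⟨a, ha, hae⟩ := hmem
  have he' : toSemisimple A a * toSemisimple A a = toSemisimple A a := by
    rw [hae, ← MulOpposite.unop_mul, he.eq]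
  obtain ⟨g, x, y, h1, h2, h3, h4⟩ := exists_idempotent_lift he'
  refine ⟨g, h2 ▸ h x a ha, h1, fun l hl => ?_⟩
  have hl' : MulOpposite.op (toSemisimple A l) ∈ I := ⟨l, hl, rfl⟩
  rw [hI, Ideal.mem_span_singleton'] at hl'
  obtain ⟨b, hb⟩ := hl'
  have hb' := congrArg MulOpposite.unop hb
  rw [MulOpposite.unop_mul, MulOpposite.unop_op, ← hae] at hb'
  rw [map_mul, ← hb', h4, ← mul_assoc, he']

/-- Every element has a partial inverse on which it is regular modulo the radical. -/
theorem exists_partial_inverse (b : A) :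
    ∃ v, v * b * v = v ∧ toSemisimple A (b * v * b) = toSemisimple A b := by
  obtain ⟨g, ⟨x, rfl⟩, h1, h2⟩ := exists_idempotent_left (AddMonoidHom.mulRight b).range (by
    rintro a _ ⟨l, rfl⟩
    exact ⟨a * l, by simp [mul_assoc]⟩)
  simp only [AddMonoidHom.coe_mulRight] at h1 h2
  refine ⟨x * b * x, ?_, ?_⟩
  · linear_combination (norm := noncomm_ring) (h1 * (x * b) + h1) * x
  · have h3 := h2 b ⟨1, by simp⟩
    rw [← h3]
    congr 1
    linear_combination (norm := noncomm_ring) b * h1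

end Ring

section Lie

variable {F A : Type*} [Field F] [Ring A] [Algebra F A]

/-- `c` and `v` are square-zero partial inverses of each other; then `c * v` and `v * c` are
orthogonal idempotents. -/
structure IsNilpotentPair (c v : A) : Prop where
  sq_left : c * c = 0
  sq_right : v * v = 0
  left : c * v * c = c
  right : v * c * v = v

theorem IsNilpotentPair.symm {c v : A} (h : IsNilpotentPair c v) : IsNilpotentPair v c :=
  ⟨h.sq_right, h.sq_left, h.right, h.left⟩

theorem IsNilpotentPair.sandwich_mem_derivedSeries (h2 : (2 : F) ≠ 0) {c v : A}
    (h : IsNilpotentPair c v) (k : ℕ) :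
    c * v - v * c ∈ derivedSeries F A k ∧ (∀ a, (c * v) * a * (v * c) ∈ derivedSeries F A k) ∧
      ∀ a, (v * c) * a * (c * v) ∈ derivedSeries F A k := by
  obtain ⟨hc, hv, hl, hr⟩ := h
  induction k with
  | zero => simp [derivedSeries]
  | succ k ih =>
    obtain ⟨ih1, ih2, ih3⟩ := ih
    have key : ∀ x ∈ derivedSeries F A k, ∀ y ∈ derivedSeries F A k,
        x * y - y * x ∈ derivedSeries F A (k + 1) :=
      fun x hx y hy => Submodule.subset_span ⟨x, hx, y, hy, rfl⟩
    refine ⟨?_, fun a => ?_, fun a => ?_⟩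
    · have e1 : c * v * c * (v * c) = c := by
        linear_combination (norm := noncomm_ring) (hl * v * c + hl)
      have e2 : v * c * v * (c * v) = v := by
        linear_combination (norm := noncomm_ring) (hr * c * v + hr)
      have := key _ (ih2 c) _ (ih3 v)
      rwa [e1, e2] at this
    · have := key _ ih1 _ (ih2 a)
      have e1 : (c * v - v * c) * (c * v * a * (v * c)) - c * v * a * (v * c) * (c * v - v * c)
          = (2 : F) • (c * v * a * (v * c)) := by
        rw [two_smul]
        linear_combination (norm := noncomm_ring) hl * v * a * v * c - v * hc * v * a * v * c
          + c * v * a * hr * c - c * v * a * v * hc * v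
      rw [e1] at this
      exact (Submodule.smul_mem_iff _ h2).1 this
    · have := key _ ih1 _ (ih3 a)
      have e1 : (c * v - v * c) * (v * c * a * (c * v)) - v * c * a * (c * v) * (c * v - v * c)
          = (-2 : F) • (v * c * a * (c * v)) := by
        rw [neg_smul, two_smul]
        linear_combination (norm := noncomm_ring) c * hv * c * a * c * v - hr * c * a * c * v
          - v * c * a * hl * v + v * c * a * c * hv * c
      rw [e1] at this
      exact (Submodule.smul_mem_iff _ (neg_ne_zero.2 h2)).1 this

theorem IsNilpotentPair.right_mem_derivedSeries (h2 : (2 : F) ≠ 0) {c v : A}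
    (h : IsNilpotentPair c v) (k : ℕ) : v ∈ derivedSeries F A k := by
  have := (h.sandwich_mem_derivedSeries (F := F) h2 k).2.2 v
  rwa [h.right, ← mul_assoc, h.right] at this

theorem IsJordanLie.triple_mem {L B : Submodule F A} (hB : IsJordanLie L B) {b d x : A}
    (hb : b ∈ B) (hd : d ∈ B) (hx : x ∈ L) : b * x * d + d * x * b ∈ B := by
  have h1 := hB.1.2 b hb d hd x hx
  have h2 : b * x * d + d * x * b = -⁅b, ⁅d, x⁆⁆ := by
    simp only [Ring.lie_def]
    linear_combination (norm := noncomm_ring) hB.2 b hb d hd * x + x * hB.2 d hd b hb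
  rw [h2]
  exact B.neg_mem h1

theorem IsJordanLie.quad_mem (h2 : (2 : F) ≠ 0) {L B : Submodule F A} (hB : IsJordanLie L B)
    {b x : A} (hb : b ∈ B) (hx : x ∈ L) : b * x * b ∈ B := by
  have h1 := hB.triple_mem hb hb hx
  rw [← two_smul F] at h1
  exact (Submodule.smul_mem_iff _ h2).1 h1

theorem IsJordanLie.peirce_mem (h2 : (2 : F) ≠ 0) {k : ℕ} {B : Submodule F A}
    (hB : IsJordanLie (derivedSeries F A k) B) {c v d : A} (hc : c ∈ B) (h : IsNilpotentPair c v)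
    (hd : d ∈ B) :
    c * v * d * (v * c) ∈ B ∧ c * v * d * (1 - v * c) + (1 - c * v) * d * (v * c) ∈ B ∧
      (1 - c * v) * d * (1 - v * c) ∈ B := by
  have m1 := hB.triple_mem hc hd (h.right_mem_derivedSeries h2 k)
  have m2 : c * v * d * (v * c) ∈ B := by
    have := hB.quad_mem h2 hc ((h.sandwich_mem_derivedSeries (F := F) h2 k).2.2 (v * d * v))
    convert this using 1
    linear_combination (norm := noncomm_ring) c * v * d * (-h.right * c) -
      c * h.right * d * v * c * v * c
  have m3 : c * v * d * (1 - v * c) + (1 - c * v) * d * (v * c) ∈ B := by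
    convert B.sub_mem m1 (B.add_mem m2 m2) using 1
    noncomm_ring
  refine ⟨m2, m3, ?_⟩
  convert B.sub_mem hd (B.add_mem m2 m3) using 1
  noncomm_ring

variable [IsArtinianRing A]

/-- A Jordan-Lie inner ideal contains a maximal regular element `c`: no element of the inner ideal
outside the radical is annihilated by the idempotents attached to `c`. -/
theorem IsJordanLie.exists_maximal_nilpotentPair [FiniteDimensional F A] (h2 : (2 : F) ≠ 0)
    {k : ℕ} {B : Submodule F A} (hB : IsJordanLie (derivedSeries F A k) B) :
    ∃ c ∈ B, ∃ v, IsNilpotentPair c v ∧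
      ∀ d ∈ B, c * v * d = 0 → d * (v * c) = 0 → toSemisimple A d = 0 := by
  let S : Set (Submodule F A) :=
    {W | ∃ c ∈ B, (∃ x, c * x * c = c) ∧ W = LinearMap.range (LinearMap.mulLeft F c)}
  obtain ⟨W, ⟨c, hc, ⟨x, hx⟩, rfl⟩, hmax⟩ :=
    (wellFounded_gt (α := Submodule F A)).has_min S ⟨_, 0, B.zero_mem, ⟨0, by simp⟩, rfl⟩
  have hcc := hB.2 c hc c hc
  obtain ⟨hv1, hv2, hv3⟩ := left_orthogonalize (v := x * c * x) hcc (by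
    linear_combination (norm := noncomm_ring) x * (hx * x * c + hx) * x)
  generalize (1 - c * (x * c * x)) * (x * c * x) = v at hv1 hv2 hv3
  have hv4 : c * v * c = c := by
    rw [hv3]
    linear_combination (norm := noncomm_ring) hx * x * c + hx
  refine ⟨c, hc, v, ⟨hcc, hv2, hv4, hv1⟩, fun d hd h1 h2' => ?_⟩
  obtain ⟨w₀, hw₀, hw₀'⟩ := exists_partial_inverse d
  have hdd := hB.2 d hd d hd
  have hcd := hB.2 c hc d hd
  have hdc := hB.2 d hd c hc
  have hd1 : d * ((1 - v * c) * w₀ * (1 - c * v)) * d = d * w₀ * d := by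
    linear_combination (norm := noncomm_ring) -h2' * w₀ * d + h2' * w₀ * c * v * d - d * w₀ * h1
  obtain ⟨hw1, hw2, hw3⟩ := left_orthogonalize (v := (1 - v * c) * w₀ * (1 - c * v)) hdd (by
    linear_combination (norm := noncomm_ring) (1 - v * c) * hw₀ * (1 - c * v)
      - (1 - v * c) * w₀ * h1 * (1 - v * c) * w₀ * (1 - c * v)
      - (1 - v * c) * w₀ * h2' * w₀ * (1 - c * v))
  have hw4 : v * c * ((1 - d * ((1 - v * c) * w₀ * (1 - c * v))) *
      ((1 - v * c) * w₀ * (1 - c * v))) = 0 := by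
    linear_combination (norm := noncomm_ring) v * hv4 * (-1) * w₀ * (1 - c * v)
      - v * hcd * ((1 - v * c) * w₀ * (1 - c * v)) * ((1 - v * c) * w₀ * (1 - c * v))
  have hw5 : ((1 - d * ((1 - v * c) * w₀ * (1 - c * v))) *
      ((1 - v * c) * w₀ * (1 - c * v))) * (c * v) = 0 := by
    linear_combination (norm := noncomm_ring)
      (1 - d * ((1 - v * c) * w₀ * (1 - c * v))) * (1 - v * c) * w₀ * (-hv4) * v
  generalize (1 - d * ((1 - v * c) * w₀ * (1 - c * v))) *
      ((1 - v * c) * w₀ * (1 - c * v)) = w at hw1 hw2 hw3 hw4 hw5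
  have hdw : d * w * d = d * w₀ * d := by rw [hw3, hd1]
  have hwL : w ∈ derivedSeries F A k := by
    have : IsNilpotentPair (d * w * d) w := by
      refine ⟨?_, hw2, ?_, ?_⟩
      · linear_combination (norm := noncomm_ring) d * w * hdd * w * d
      · linear_combination (norm := noncomm_ring) d * hw1 * d * w * d + d * hw1 * d
      · linear_combination (norm := noncomm_ring) hw1 * d * w + hw1
    exact this.right_mem_derivedSeries h2 k
  have hdB : d * w * d ∈ B := hB.quad_mem h2 hd hwL
  rw [← hw₀', ← hdw]
  have hcw : c * w = 0 := by
    linear_combination (norm := noncomm_ring) c * hw4 - hv4 * w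
  have hwc : w * c = 0 := by
    linear_combination (norm := noncomm_ring) hw5 * c - w * hv4
  have hdv : d * v = 0 := by
    linear_combination (norm := noncomm_ring) h2' * v - d * hv1
  have hvd : v * d = 0 := by
    linear_combination (norm := noncomm_ring) v * h1 - hv1 * d
  have hreg : (c + d * w * d) * (v + w) * (c + d * w * d) = c + d * w * d := by
    linear_combination (norm := noncomm_ring) hv4 + hcw * (c + d * w * d) +
      d * w * hdv * (c + d * w * d) + c * hvd * w * d + d * w * d * hwc + d * hw1 * (d * w * d)
      + d * hw1 * d
  have hle : ¬ LinearMap.range (LinearMap.mulLeft F (c + d * w * d)) >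
      LinearMap.range (LinearMap.mulLeft F c) :=
    hmax _ ⟨_, B.add_mem hc hdB, ⟨v + w, hreg⟩, rfl⟩
  have hsub : LinearMap.range (LinearMap.mulLeft F c) ≤
      LinearMap.range (LinearMap.mulLeft F (c + d * w * d)) := by
    rintro _ ⟨a, rfl⟩
    refine ⟨v * c * a, ?_⟩
    simp only [LinearMap.mulLeft_apply]
    linear_combination (norm := noncomm_ring) hv4 * a + d * w * hdv * c * a
  have hmem : d * w * d ∈ LinearMap.range (LinearMap.mulLeft F c) := by
    rw [hsub.antisymm (not_not.1 fun hne => hle (lt_of_le_not_ge hsub hne))]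
    refine ⟨w * d, ?_⟩
    simp only [LinearMap.mulLeft_apply]
    linear_combination (norm := noncomm_ring) hcw * d + d * hw1 * d
  obtain ⟨a, ha⟩ := hmem
  simp only [LinearMap.mulLeft_apply] at ha
  have : d * w * d = 0 := by
    linear_combination (norm := noncomm_ring) h1 * w * d - hv4 * a + c * v * ha - ha
  rw [this, map_zero]


theorem IsJordanLie.exists_left_component (h2 : (2 : F) ≠ 0) {k : ℕ} {B : Submodule F A}
    (hB : IsJordanLie (derivedSeries F A k) B) {c v d : A} (hc : c ∈ B) (h : IsNilpotentPair c v)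
    (hd : d ∈ B) :
    ∃ y ∈ B, c * v * y = y ∧ y * (v * c) = 0 ∧
      toSemisimple A y = toSemisimple A (c * v * d * (1 - v * c)) := by
  have hyz := (hB.peirce_mem h2 hc h hd).2.1
  have hdc := hB.2 d hd c hc
  obtain ⟨hcc, hvv, hl, hr⟩ := h
  have y1 : c * v * (c * v * d * (1 - v * c)) = c * v * d * (1 - v * c) := by
    linear_combination (norm := noncomm_ring) hl * (v * d * (1 - v * c))
  have y2 : c * v * d * (1 - v * c) * (v * c) = 0 := by
    linear_combination (norm := noncomm_ring) -(c * v * d) * hr * c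
  have y3 : v * c * (c * v * d * (1 - v * c)) = 0 := by
    linear_combination (norm := noncomm_ring) v * hcc * (v * d * (1 - v * c))
  have y4 : c * v * d * (1 - v * c) * (c * v * d * (1 - v * c)) = 0 := by
    linear_combination (norm := noncomm_ring) c * v * hdc * (v * d * (1 - v * c))
      - c * v * d * v * hcc * (v * d * (1 - v * c))
  generalize c * v * d * (1 - v * c) = y at hyz y1 y2 y3 y4
  obtain ⟨w₀, hw₀, hw₀'⟩ := exists_partial_inverse y
  have hy : y * ((1 - v * c) * w₀ * (c * v)) * y = y * w₀ * y := by
    linear_combination (norm := noncomm_ring) y * (1 - v * c) * w₀ * y1 - y2 * w₀ * y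
  obtain ⟨hw1, hw2, hw3⟩ := left_orthogonalize (v := (1 - v * c) * w₀ * (c * v)) y4 (by
    linear_combination (norm := noncomm_ring) (1 - v * c) * hw₀ * (c * v)
      + (1 - v * c) * w₀ * y1 * (1 - v * c) * w₀ * (c * v)
      - (1 - v * c) * w₀ * y2 * w₀ * (c * v))
  have hw4 : v * c * ((1 - y * ((1 - v * c) * w₀ * (c * v))) *
      ((1 - v * c) * w₀ * (c * v))) = 0 := by
    linear_combination (norm := noncomm_ring) -hr * c * w₀ * (c * v)
      - y3 * ((1 - v * c) * w₀ * (c * v)) * ((1 - v * c) * w₀ * (c * v))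
  have hw5 : ((1 - y * ((1 - v * c) * w₀ * (c * v))) *
      ((1 - v * c) * w₀ * (c * v))) * (c * v) = ((1 - y * ((1 - v * c) * w₀ * (c * v))) *
      ((1 - v * c) * w₀ * (c * v))) := by
    linear_combination (norm := noncomm_ring)
      (1 - y * ((1 - v * c) * w₀ * (c * v))) * (1 - v * c) * w₀ * hl * v
  generalize (1 - y * ((1 - v * c) * w₀ * (c * v))) *
      ((1 - v * c) * w₀ * (c * v)) = w at hw1 hw2 hw3 hw4 hw5
  have hyw : y * w * y = y * w₀ * y := by rw [hw3, hy]
  have hwL : w ∈ derivedSeries F A k := by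
    have : IsNilpotentPair (y * w * y) w := by
      refine ⟨?_, hw2, ?_, ?_⟩
      · linear_combination (norm := noncomm_ring) y * w * y4 * w * y
      · linear_combination (norm := noncomm_ring) y * hw1 * y * w * y + y * hw1 * y
      · linear_combination (norm := noncomm_ring) hw1 * y * w + hw1
    exact this.right_mem_derivedSeries h2 k
  refine ⟨y * w * y, ?_, ?_, ?_, ?_⟩
  · convert hB.quad_mem h2 hyz hwL using 1
    linear_combination (norm := noncomm_ring)
      y * hw5 * ((1 - c * v) * d * (v * c)) + y * w * hl * v * d * (v * c)
      - (1 - c * v) * d * hw4 * (y + (1 - c * v) * d * (v * c))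
  · linear_combination (norm := noncomm_ring) y1 * w * y
  · linear_combination (norm := noncomm_ring) y * w * y2
  · rw [hyw, hw₀']

theorem IsJordanLie.exists_right_component (h2 : (2 : F) ≠ 0) {k : ℕ} {B : Submodule F A}
    (hB : IsJordanLie (derivedSeries F A k) B) {c v d : A} (hc : c ∈ B) (h : IsNilpotentPair c v)
    (hd : d ∈ B) :
    ∃ z ∈ B, c * v * z = 0 ∧ z * (v * c) = z ∧
      toSemisimple A z = toSemisimple A ((1 - c * v) * d * (v * c)) := by
  have hyz := (hB.peirce_mem h2 hc h hd).2.1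
  have hcd := hB.2 c hc d hd
  obtain ⟨hcc, hvv, hl, hr⟩ := h
  have z1 : (1 - c * v) * d * (v * c) * (v * c) = (1 - c * v) * d * (v * c) := by
    linear_combination (norm := noncomm_ring) (1 - c * v) * d * hr * c
  have z2 : c * v * ((1 - c * v) * d * (v * c)) = 0 := by
    linear_combination (norm := noncomm_ring) -hl * v * d * v * c
  have z3 : (1 - c * v) * d * (v * c) * (c * v) = 0 := by
    linear_combination (norm := noncomm_ring) (1 - c * v) * d * v * hcc * v
  have z4 : (1 - c * v) * d * (v * c) * ((1 - c * v) * d * (v * c)) = 0 := by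
    linear_combination (norm := noncomm_ring) (1 - c * v) * d * v * hcd * v * c
      - (1 - c * v) * d * v * hcc * v * d * v * c
  generalize (1 - c * v) * d * (v * c) = z at hyz z1 z2 z3 z4
  obtain ⟨w₀, hw₀, hw₀'⟩ := exists_partial_inverse z
  have hz : z * (v * c * w₀ * (1 - c * v)) * z = z * w₀ * z := by
    linear_combination (norm := noncomm_ring) z1 * w₀ * (1 - c * v) * z - z * w₀ * z2
  obtain ⟨hw1, hw2, hw3⟩ := right_orthogonalize (v := v * c * w₀ * (1 - c * v)) z4 (by
    linear_combination (norm := noncomm_ring) v * c * hw₀ * (1 - c * v)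
      + v * c * w₀ * (1 - c * v) * z1 * w₀ * (1 - c * v)
      - v * c * w₀ * z2 * w₀ * (1 - c * v))
  have hw4 : v * c * w₀ * (1 - c * v) * (1 - v * c * w₀ * (1 - c * v) * z) * (c * v) = 0 := by
    linear_combination (norm := noncomm_ring) -v * c * w₀ * hl * v
      - (v * c * w₀ * (1 - c * v)) * (v * c * w₀ * (1 - c * v)) * z3
  have hw5 : v * c * (v * c * w₀ * (1 - c * v) * (1 - v * c * w₀ * (1 - c * v) * z)) =
      v * c * w₀ * (1 - c * v) * (1 - v * c * w₀ * (1 - c * v) * z) := by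
    linear_combination (norm := noncomm_ring)
      hr * c * w₀ * (1 - c * v) * (1 - v * c * w₀ * (1 - c * v) * z)
  generalize v * c * w₀ * (1 - c * v) * (1 - v * c * w₀ * (1 - c * v) * z) = w
    at hw1 hw2 hw3 hw4 hw5
  have hzw : z * w * z = z * w₀ * z := by rw [mul_assoc, hw3, ← mul_assoc, hz]
  have hwL : w ∈ derivedSeries F A k := by
    have : IsNilpotentPair (z * w * z) w := by
      refine ⟨?_, hw2, ?_, ?_⟩
      · linear_combination (norm := noncomm_ring) z * w * z4 * w * z
      · linear_combination (norm := noncomm_ring) z * hw1 * z * w * z + z * hw1 * z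
      · linear_combination (norm := noncomm_ring) hw1 * z * w + hw1
    exact this.right_mem_derivedSeries h2 k
  refine ⟨z * w * z, ?_, ?_, ?_, ?_⟩
  · convert hB.quad_mem h2 hyz hwL using 1
    linear_combination (norm := noncomm_ring)
      c * v * d * hw5 * (z + c * v * d * (1 - v * c)) - z * hw4 * d * (1 - v * c)
  · linear_combination (norm := noncomm_ring) z2 * w * z
  · linear_combination (norm := noncomm_ring) z * w * z1
  · rw [hzw, hw₀']

/-- Assembling an idempotent pair from a left ideal `Y` and a right ideal `Z` which extend a pair
of orthogonal idempotents. -/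
theorem exists_strictPair_of_ideals {B : Submodule F A} {e f : A} {Y Z : Submodule F A}
    (he : e * e = e) (hf : f * f = f) (hef : e * f = 0) (hfe : f * e = 0)
    (hstrict : ∀ u : A, (∀ a, toSemisimple A (u * a) = toSemisimple A (a * u)) →
      (toSemisimple A (u * e) = 0 ↔ toSemisimple A (u * f) = 0))
    (hefB : ∀ a, e * a * f ∈ B)
    (hY : ∀ a, ∀ l ∈ Y, a * l ∈ Y) (hZ : ∀ a, ∀ m ∈ Z, m * a ∈ Z)
    (hYB : ∀ l ∈ Y, ∀ a, e * a * l ∈ B) (hZB : ∀ m ∈ Z, ∀ a, m * a * f ∈ B)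
    (hYe : ∀ l ∈ Y, l * e = 0) (hYf : ∀ l ∈ Y, l * f = 0)
    (hZe : ∀ m ∈ Z, e * m = 0) (hZf : ∀ m ∈ Z, f * m = 0)
    (hYu : ∀ u : A, (∀ a, toSemisimple A (u * a) = toSemisimple A (a * u)) →
      toSemisimple A (u * e) = 0 → ∀ l ∈ Y, toSemisimple A (u * l) = 0)
    (hZu : ∀ u : A, (∀ a, toSemisimple A (u * a) = toSemisimple A (a * u)) →
      toSemisimple A (u * f) = 0 → ∀ m ∈ Z, toSemisimple A (u * m) = 0)
    (hYZ : ∀ l ∈ Y, ∀ m ∈ Z, l * m = 0) (hZY : ∀ m ∈ Z, ∀ l ∈ Y, ∀ a, m * a * l ∈ B)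
    (hcover : ∀ b ∈ B, ∃ x, ∃ y ∈ Y, ∃ z ∈ Z, e * y = y ∧ z * f = z ∧
      toSemisimple A b = toSemisimple A (e * x * f + y + z)) :
    ∃ e' f' : A, IsStrictPair e' f' ∧ e' * f' = 0 ∧ f' * e' = 0 ∧
      (∀ a, e' * a * f' ∈ B) ∧ ∀ b ∈ B, toSemisimple A (e' * b * f') = toSemisimple A b := by
  obtain ⟨g₀, hg₀, hgg₀, hg₀'⟩ := exists_idempotent_left Y.toAddSubgroup hY
  obtain ⟨h₀, hh₀, hhh₀, hh₀'⟩ := exists_idempotent_right Z.toAddSubgroup hZ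
  rw [Submodule.mem_toAddSubgroup] at hg₀ hh₀
  obtain ⟨g, hg⟩ : ∃ g, g = (1 - e - f) * g₀ := ⟨_, rfl⟩
  have hgY : g ∈ Y := hg ▸ hY _ _ hg₀
  have hge := hYe g hgY
  have hgf := hYf g hgY
  have heg : e * g = 0 := by
    rw [hg]
    linear_combination (norm := noncomm_ring) -he * g₀ - hef * g₀
  have hfg : f * g = 0 := by
    rw [hg]
    linear_combination (norm := noncomm_ring) -hf * g₀ - hfe * g₀
  have hYg : ∀ l ∈ Y, l * g = l * g₀ := fun l hl => by
    rw [hg]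
    linear_combination (norm := noncomm_ring) -hYe l hl * g₀ - hYf l hl * g₀
  have hgg : g * g = g := by
    rw [hYg g hgY, hg, mul_assoc, hgg₀]
  obtain ⟨h, hh⟩ : ∃ h, h = h₀ * (1 - e - f) * (1 - g) := ⟨_, rfl⟩
  have hhZ : h ∈ Z := by
    rw [hh, mul_assoc]
    exact hZ _ _ hh₀
  have heh := hZe h hhZ
  have hfh := hZf h hhZ
  have hgh := hYZ g hgY h hhZ
  have hhg : h * g = 0 := by
    rw [hh]
    linear_combination (norm := noncomm_ring) - h₀ * (1 - e - f) * hgg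
  have hhe : h * e = 0 := by
    rw [hh]
    linear_combination (norm := noncomm_ring) - h₀ * (1 - e - f) * hge - h₀ * he - h₀ * hfe
  have hhf : h * f = 0 := by
    rw [hh]
    linear_combination (norm := noncomm_ring) - h₀ * (1 - e - f) * hgf - h₀ * hf - h₀ * hef
  have hZh : ∀ m ∈ Z, h * m = h₀ * m := fun m hm => by
    rw [hh]
    linear_combination (norm := noncomm_ring) -h₀ * (1 - e - f) * hYZ g hgY m hm
      - h₀ * hZe m hm - h₀ * hZf m hm
  have hhh : h * h = h := by
    rw [hZh h hhZ, hh, ← mul_assoc, ← mul_assoc, hhh₀]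
  have central : ∀ u : A, IsPrimitiveCentralIdempotentMod Set.univ
      ((Ideal.jacobson (⊥ : Ideal A)) : Set A) u →
      ∀ a, toSemisimple A (u * a) = toSemisimple A (a * u) := fun u hu a => by
    rw [← sub_eq_zero, ← map_sub, toSemisimple_eq_zero_iff]
    exact hu.1.2.1 a trivial
  refine ⟨e + h, f + g, ⟨?_, ?_, fun u hu => ?_⟩, ?_, ?_, fun a => ?_, fun b hb => ?_⟩
  · linear_combination (norm := noncomm_ring) he + heh + hhe + hhh
  · linear_combination (norm := noncomm_ring) hf + hfg + hgf + hgg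
  · have hcu := central u hu
    simp only [SetLike.mem_coe, ← toSemisimple_eq_zero_iff]
    constructor
    · intro hu0
      have h1 : toSemisimple A (u * e) = 0 := by
        have : u * e = u * (e + h) * e := by
          linear_combination (norm := noncomm_ring) -u * he - u * hhe
        rw [this, map_mul, hu0, zero_mul]
      rw [mul_add, map_add, (hstrict u hcu).1 h1, hYu u hcu h1 g hgY, add_zero]
    · intro hu0
      have h1 : toSemisimple A (u * f) = 0 := by
        have : u * f = u * (f + g) * f := by
          linear_combination (norm := noncomm_ring) -u * hf - u * hgf
        rw [this, map_mul, hu0, zero_mul]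
      rw [mul_add, map_add, (hstrict u hcu).2 h1, hZu u hcu h1 h hhZ, add_zero]
  · linear_combination (norm := noncomm_ring) hef + heg + hhf + hhg
  · linear_combination (norm := noncomm_ring) hfe + hfh + hge + hgh
  · have : (e + h) * a * (f + g) = e * a * f + e * a * g + h * a * f + h * a * g := by
      noncomm_ring
    rw [this]
    exact B.add_mem (B.add_mem (B.add_mem (hefB a) (hYB g hgY a)) (hZB h hhZ a))
      (hZY h hhZ g hgY a)
  · obtain ⟨x, y, hy, z, hz, hey, hzf, hb'⟩ := hcover b hb
    have e1 : (e + h) * (e * x * f + y + z) * (f + g) = e * x * f + y * g₀ + h₀ * z := by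
      rw [← hYg y hy, ← hZh z hz]
      have hhy : h * y = 0 := by rw [← hey, ← mul_assoc, hhe, zero_mul]
      have hzg : z * g = 0 := by rw [← hzf, mul_assoc, hfg, mul_zero]
      have hez := hZe z hz
      have hyf := hYf y hy
      linear_combination (norm := noncomm_ring) he * x * f * (f + g) + e * x * hf + e * x * hfg
        + hhe * x * f * (f + g) + hey * (f + g) + hhy * (f + g) + hez * (f + g)
        + hyf + h * hzf + h * hzg
    rw [map_mul, map_mul, hb', ← map_mul, ← map_mul, e1, map_add, map_add, hg₀' y hy, hh₀' z hz,
      map_add, map_add]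

theorem IsJordanLie.exists_strictPair [FiniteDimensional F A] (h2 : (2 : F) ≠ 0)
    {k : ℕ} {B : Submodule F A} (hB : IsJordanLie (derivedSeries F A k) B) :
    ∃ e f : A, IsStrictPair e f ∧ e * f = 0 ∧ f * e = 0 ∧
      (∀ a, e * a * f ∈ B) ∧ ∀ b ∈ B, toSemisimple A (e * b * f) = toSemisimple A b := by
  obtain ⟨c, hc, v, hcv, hmax⟩ := hB.exists_maximal_nilpotentPair h2
  have hL := hcv.sandwich_mem_derivedSeries (F := F) h2 k
  obtain ⟨hcc, hvv, hl, hr⟩ := id hcv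
  have hcB : ∀ b ∈ B, c * b = 0 := hB.2 c hc
  have hBc : ∀ b ∈ B, b * c = 0 := fun b hb => hB.2 b hb c hc
  -- `v * a * (c * v)` and `v * c * a * v` both lie in the derived series
  have hvL : ∀ a, v * a * (c * v) ∈ derivedSeries F A k := fun a => by
    have := hL.2.2 (v * a)
    rwa [← mul_assoc (v * c), hr] at this
  have hvL' : ∀ a, v * c * a * v ∈ derivedSeries F A k := fun a => by
    have := hL.2.2 (a * v)
    rwa [mul_assoc, mul_assoc a, ← mul_assoc v c v, hr, ← mul_assoc] at this
  let Y : Submodule F A :=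
    Submodule.span F {l | ∃ a, ∃ y ∈ B, c * v * y = y ∧ y * (v * c) = 0 ∧ l = a * y}
  let Z : Submodule F A :=
    Submodule.span F {m | ∃ z ∈ B, ∃ a, c * v * z = 0 ∧ z * (v * c) = z ∧ m = z * a}
  have indY : ∀ (P : A → Prop), P 0 → (∀ l m, P l → P m → P (l + m)) →
      (∀ (r : F) l, P l → P (r • l)) →
      (∀ a, ∀ y ∈ B, c * v * y = y → y * (v * c) = 0 → P (a * y)) → ∀ l ∈ Y, P l := by
    intro P h0 ha hs hm l hl
    induction hl using Submodule.span_induction with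
    | zero => exact h0
    | add x y _ _ hx hy => exact ha x y hx hy
    | smul r x _ hx => exact hs r x hx
    | mem x hx =>
      obtain ⟨a, y, hy, h1, h2, rfl⟩ := hx
      exact hm a y hy h1 h2
  have indZ : ∀ (P : A → Prop), P 0 → (∀ l m, P l → P m → P (l + m)) →
      (∀ (r : F) l, P l → P (r • l)) →
      (∀ z ∈ B, ∀ a, c * v * z = 0 → z * (v * c) = z → P (z * a)) → ∀ m ∈ Z, P m := by
    intro P h0 ha hs hm l hl
    induction hl using Submodule.span_induction with
    | zero => exact h0
    | add x y _ _ hx hy => exact ha x y hx hy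
    | smul r x _ hx => exact hs r x hx
    | mem x hx =>
      obtain ⟨z, hz, a, h1, h2, rfl⟩ := hx
      exact hm z hz a h1 h2
  have smul_zero_of : ∀ (r : F) (l : A), toSemisimple A l = 0 → toSemisimple A (r • l) = 0 :=
    fun r l h => by rw [Algebra.smul_def, map_mul, h, mul_zero]
  refine exists_strictPair_of_ideals (B := B) (e := c * v) (f := v * c) (Y := Y) (Z := Z)
    ?_ ?_ ?_ ?_ ?_ ?_ ?_ ?_ ?_ ?_ ?_ ?_ ?_ ?_ ?_ ?_ ?_ ?_ ?_
  · rw [← mul_assoc, hl]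
  · rw [← mul_assoc, hr]
  · rw [mul_assoc, ← mul_assoc v, hvv, zero_mul, mul_zero]
  · rw [mul_assoc, ← mul_assoc c, hcc, zero_mul, mul_zero]
  · intro u hu
    refine ⟨fun h => toSemisimple_mul_eq_zero hu h v c ?_,
      fun h => toSemisimple_mul_eq_zero hu h c v ?_⟩
    · linear_combination (norm := noncomm_ring) -hr * c
    · linear_combination (norm := noncomm_ring) -hl * v
  · intro a
    have := hB.quad_mem h2 hc (hL.2.2 (v * a * v))
    convert this using 1
    linear_combination (norm := noncomm_ring) -c * v * a * hr * c - c * hr * a * v * c * v * c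
  · intro a l hl
    refine indY (fun l => a * l ∈ Y) (by simp) (fun l m h1 h2 => ?_) (fun r l h => ?_) ?_ l hl
    · simpa only [mul_add] using Y.add_mem h1 h2
    · simpa only [mul_smul_comm] using Y.smul_mem r h
    · intro b y hy h1 h2
      exact Submodule.subset_span ⟨a * b, y, hy, h1, h2, (mul_assoc _ _ _).symm⟩
  · intro a l hl
    refine indZ (fun l => l * a ∈ Z) (by simp) (fun l m h1 h2 => ?_) (fun r l h => ?_) ?_ l hl
    · simpa only [add_mul] using Z.add_mem h1 h2
    · simpa only [smul_mul_assoc] using Z.smul_mem r h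
    · intro z hz b h1 h2
      exact Submodule.subset_span ⟨z, hz, b * a, h1, h2, mul_assoc _ _ _⟩
  · refine indY _ (by simp) (fun l m h1 h2 a => ?_) (fun r l h a => ?_) ?_
    · simpa only [mul_add] using B.add_mem (h1 a) (h2 a)
    · simpa only [mul_smul_comm] using B.smul_mem r (h a)
    · intro b y hy h1 h2 a
      have := hB.triple_mem hc hy (hvL (a * b))
      convert this using 1
      have hyv : y * v = 0 := by
        linear_combination (norm := noncomm_ring) h2 * v - y * hr
      linear_combination (norm := noncomm_ring) -c * v * a * b * h1 - hyv * (a * b) * (c * v) * c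
  · refine indZ _ (by simp) (fun l m h1 h2 a => ?_) (fun r l h a => ?_) ?_
    · simpa only [add_mul] using B.add_mem (h1 a) (h2 a)
    · simpa only [smul_mul_assoc] using B.smul_mem r (h a)
    · intro z hz b h1 h2 a
      have := hB.triple_mem hz hc (hvL' (b * a))
      convert this using 1
      have hvz : v * z = 0 := by
        linear_combination (norm := noncomm_ring) v * h1 - hr * z
      linear_combination (norm := noncomm_ring) -h2 * b * a * v * c - c * v * c * b * a * hvz
  · refine indY _ (by simp) (fun l m h1 h2 => by rw [add_mul, h1, h2, add_zero])
      (fun r l h => by rw [smul_mul_assoc, h, smul_zero]) ?_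
    intro b y hy h1 h2
    rw [mul_assoc, ← mul_assoc y, hBc y hy, zero_mul, mul_zero]
  · refine indY _ (by simp) (fun l m h1 h2 => by rw [add_mul, h1, h2, add_zero])
      (fun r l h => by rw [smul_mul_assoc, h, smul_zero]) ?_
    intro b y hy h1 h2
    rw [mul_assoc, h2, mul_zero]
  · refine indZ _ (by simp) (fun l m h1 h2 => by rw [mul_add, h1, h2, add_zero])
      (fun r l h => by rw [mul_smul_comm, h, smul_zero]) ?_
    intro z hz b h1 h2
    rw [← mul_assoc, h1, zero_mul]
  · refine indZ _ (by simp) (fun l m h1 h2 => by rw [mul_add, h1, h2, add_zero])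
      (fun r l h => by rw [mul_smul_comm, h, smul_zero]) ?_
    intro z hz b h1 h2
    rw [← mul_assoc, mul_assoc v, hcB z hz, mul_zero, zero_mul]
  · intro u hu hu0
    refine indY _ (by simp) (fun l m h1 h2 => by rw [mul_add, map_add, h1, h2, add_zero])
      (fun r l h => by rw [mul_smul_comm]; exact smul_zero_of r _ h) ?_
    intro b y hy h1 h2
    exact toSemisimple_mul_eq_zero hu hu0 b y (by rw [mul_assoc, h1])
  · intro u hu hu0
    refine indZ _ (by simp) (fun l m h1 h2 => by rw [mul_add, map_add, h1, h2, add_zero])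
      (fun r l h => by rw [mul_smul_comm]; exact smul_zero_of r _ h) ?_
    intro z hz b h1 h2
    exact toSemisimple_mul_eq_zero hu hu0 z b (by rw [h2])
  · intro l hl m hm
    revert l
    refine indY _ (by simp) (fun l m h1 h2 => by rw [add_mul, h1, h2, add_zero])
      (fun r l h => by rw [smul_mul_assoc, h, smul_zero]) ?_
    intro b y hy h1 h2
    revert m
    refine indZ _ (by simp) (fun l m h1 h2 => by rw [mul_add, h1, h2, add_zero])
      (fun r l h => by rw [mul_smul_comm, h, smul_zero]) ?_
    intro z hz a h3 h4
    rw [mul_assoc, ← mul_assoc y, hB.2 y hy z hz, zero_mul, mul_zero]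
  · refine indZ _ (by simp) (fun l m h1 h2 x hx a => ?_) (fun r l h x hx a => ?_) ?_
    · simpa only [add_mul] using B.add_mem (h1 x hx a) (h2 x hx a)
    · simpa only [smul_mul_assoc] using B.smul_mem r (h x hx a)
    intro z hz b h1 h2
    refine indY _ (by simp) (fun l m h1 h2 a => ?_) (fun r l h a => ?_) ?_
    · simpa only [mul_add] using B.add_mem (h1 a) (h2 a)
    · simpa only [mul_smul_comm] using B.smul_mem r (h a)
    intro d y hy h3 h4 a
    have := hB.triple_mem hz hy (hL.2.2 (b * a * d))
    convert this using 1
    linear_combination (norm := noncomm_ring) -z * b * a * d * h3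
      - h2 * b * a * d * c * v * y - h4 * b * a * d * c * v * z
  · intro b hb
    obtain ⟨y, hy, h1, h2', h3⟩ := hB.exists_left_component h2 hc hcv hb
    obtain ⟨z, hz, h4, h5, h6⟩ := hB.exists_right_component h2 hc hcv hb
    refine ⟨b, y, Submodule.subset_span ⟨1, y, hy, h1, h2', (one_mul _).symm⟩,
      z, Submodule.subset_span ⟨z, hz, 1, h4, h5, (mul_one _).symm⟩, h1, h5, ?_⟩
    have h7 := hmax _ (hB.peirce_mem h2 hc hcv hb).2.2
      (by linear_combination (norm := noncomm_ring) -hl * v * b * (1 - v * c))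
      (by linear_combination (norm := noncomm_ring) -(1 - c * v) * b * hr * c)
    rw [map_add, map_add, h3, h6, ← map_add, ← map_add, ← sub_eq_zero, ← map_sub, ← h7]
    congr 1
    noncomm_ring


theorem isCentralIdempotentMod_jacobson_iff {R : Type*} [Ring R] {u : R} :
    IsCentralIdempotentMod Set.univ ((Ideal.jacobson (⊥ : Ideal R)) : Set R) u ↔
      (∀ a, toSemisimple R (u * a) = toSemisimple R (a * u)) ∧
        toSemisimple R u * toSemisimple R u = toSemisimple R u := by
  simp only [IsCentralIdempotentMod, Set.mem_univ, true_and, forall_true_left, SetLike.mem_coe,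
    ← toSemisimple_eq_zero_iff, map_sub, map_mul, sub_eq_zero]

theorem mem_radical_iff {R : Type*} [Ring R] [Algebra F R] {x : R} :
    x ∈ (radical : Submodule F R) ↔ toSemisimple R x = 0 := by
  rw [toSemisimple_eq_zero_iff]
  rfl

/-- A central idempotent modulo the radical which kills `f` but not `e` can be shrunk to a primitive
one. -/
theorem exists_primitiveCentralIdempotentMod (F : Type*) {A : Type*} [Field F] [Ring A] [Algebra F A]
    [FiniteDimensional F A] {e f u₀ : A}
    (hu₀ : IsCentralIdempotentMod Set.univ ((Ideal.jacobson (⊥ : Ideal A)) : Set A) u₀)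
    (hf₀ : toSemisimple A (u₀ * f) = 0) (he₀ : toSemisimple A (u₀ * e) ≠ 0) :
    ∃ u, IsPrimitiveCentralIdempotentMod Set.univ ((Ideal.jacobson (⊥ : Ideal A)) : Set A) u ∧
      toSemisimple A (u * f) = 0 ∧ toSemisimple A (u * e) ≠ 0 := by
  let W : A → Submodule F A := fun u => (radical : Submodule F A).comap (LinearMap.mulLeft F (1 - u))
  have hW : ∀ u x, x ∈ W u ↔ toSemisimple A x = toSemisimple A (u * x) := fun u x => by
    simp only [W, Submodule.mem_comap, mem_radical_iff, LinearMap.mulLeft_apply, sub_mul, one_mul,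
      map_sub, sub_eq_zero]
  obtain ⟨_, ⟨u, hu, hf, he, rfl⟩, hmin⟩ :=
    (wellFounded_lt (α := Submodule F A)).has_min
      {V | ∃ u, IsCentralIdempotentMod Set.univ ((Ideal.jacobson (⊥ : Ideal A)) : Set A) u ∧
        toSemisimple A (u * f) = 0 ∧ toSemisimple A (u * e) ≠ 0 ∧ V = W u}
      ⟨_, u₀, hu₀, hf₀, he₀, rfl⟩
  refine ⟨u, ⟨hu, fun h => he ?_, ?_⟩, hf, he⟩
  · rw [map_mul, toSemisimple_eq_zero_iff.2 h, zero_mul]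
  rintro ⟨c₁, c₂, h1, h2, hn1, hn2, h12, h21, hs⟩
  rw [SetLike.mem_coe, ← toSemisimple_eq_zero_iff] at hn1 hn2 h12 h21 hs
  rw [map_sub, map_add, sub_eq_zero] at hs
  rw [map_mul] at h12 h21
  have key : ∀ c d : A,
      IsCentralIdempotentMod Set.univ ((Ideal.jacobson (⊥ : Ideal A)) : Set A) c →
      IsCentralIdempotentMod Set.univ ((Ideal.jacobson (⊥ : Ideal A)) : Set A) d →
      toSemisimple A d ≠ 0 → toSemisimple A c * toSemisimple A d = 0 →
      toSemisimple A d * toSemisimple A c = 0 →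
      toSemisimple A u = toSemisimple A c + toSemisimple A d → toSemisimple A (c * e) = 0 := by
    intro c d hc hd hd0 hcd hdc hcds
    by_contra hce
    have hcc := (isCentralIdempotentMod_jacobson_iff.1 hc).2
    have hdd := (isCentralIdempotentMod_jacobson_iff.1 hd).2
    have hcu : toSemisimple A c * toSemisimple A u = toSemisimple A c := by
      rw [hcds, mul_add, hcc, hcd, add_zero]
    have huc : toSemisimple A u * toSemisimple A c = toSemisimple A c := by
      rw [hcds, add_mul, hcc, hdc, add_zero]
    have hud : toSemisimple A u * toSemisimple A d = toSemisimple A d := by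
      rw [hcds, add_mul, hdd, hcd, zero_add]
    refine hmin (W c) ⟨c, hc, ?_, hce, rfl⟩ (lt_of_le_not_ge (fun x hx => ?_) fun hle => hd0 ?_)
    · rw [map_mul, ← hcu, mul_assoc, ← map_mul _ u, hf, mul_zero]
    · rw [hW, map_mul] at hx ⊢
      rw [hx, ← mul_assoc, huc]
    · have hdW : d ∈ W c := hle ((hW u d).2 (by rw [map_mul, hud]))
      rw [hW, map_mul, hcd] at hdW
      exact hdW
  apply he
  rw [map_mul, hs, add_mul, ← map_mul, ← map_mul, key c₁ c₂ h1 h2 hn2 h12 h21 hs,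
    key c₂ c₁ h2 h1 hn1 h21 h12 (by rw [hs, add_comm]), add_zero]

/-- If every primitive central idempotent modulo the radical which kills `f` also kills the
idempotent `e`, then `e` lies in the ideal generated by `f`. -/
theorem mem_span_of_primitiveCentralIdempotentMod (F : Type*) {A : Type*} [Field F] [Ring A]
    [Algebra F A] [FiniteDimensional F A] {e f : A} (he : e * e = e)
    (h : ∀ u, IsPrimitiveCentralIdempotentMod Set.univ ((Ideal.jacobson (⊥ : Ideal A)) : Set A) u →
      toSemisimple A (u * f) = 0 → toSemisimple A (u * e) = 0) :
    e ∈ Submodule.span F {x | ∃ a b, x = a * f * b} := by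
  have : IsArtinianRing A := IsArtinianRing.of_finite F A
  set I := Submodule.span F {x | ∃ a b, x = a * f * b} with hI
  have hl : ∀ a, ∀ l ∈ I, a * l ∈ I := by
    intro a l hl
    induction hl using Submodule.span_induction with
    | zero => simp
    | add x y _ _ hx hy => simpa only [mul_add] using I.add_mem hx hy
    | smul r x _ hx => simpa only [mul_smul_comm] using I.smul_mem r hx
    | mem x hx =>
      obtain ⟨b, c, rfl⟩ := hx
      exact Submodule.subset_span ⟨a * b, c, by noncomm_ring⟩
  have hr : ∀ a, ∀ l ∈ I, l * a ∈ I := by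
    intro a l hl
    induction hl using Submodule.span_induction with
    | zero => simp
    | add x y _ _ hx hy => simpa only [add_mul] using I.add_mem hx hy
    | smul r x _ hx => simpa only [smul_mul_assoc] using I.smul_mem r hx
    | mem x hx =>
      obtain ⟨b, c, rfl⟩ := hx
      exact Submodule.subset_span ⟨b, c * a, by noncomm_ring⟩
  have hfI : f ∈ I := Submodule.subset_span ⟨1, 1, by noncomm_ring⟩
  obtain ⟨g, hg, hgg, hg'⟩ := exists_idempotent_left I.toAddSubgroup hl
  obtain ⟨g₂, hg₂, -, hg₂'⟩ := exists_idempotent_right I.toAddSubgroup hr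
  rw [Submodule.mem_toAddSubgroup] at hg hg₂
  have hgg₂ : toSemisimple A g₂ = toSemisimple A g := by
    rw [← hg₂' g hg, ← hg' g₂ hg₂]
  have hcentral : ∀ a, toSemisimple A (g * a) = toSemisimple A (a * g) := fun a => by
    rw [← hg' _ (hr a g hg), ← hg₂' _ (hl a g hg)]
    simp only [map_mul, hgg₂, mul_assoc]
  have hge : toSemisimple A ((1 - g) * e) = 0 := by
    by_contra hne
    obtain ⟨u, hu, huf, hue⟩ := exists_primitiveCentralIdempotentMod F (u₀ := 1 - g) (f := f)
      (isCentralIdempotentMod_jacobson_iff.2 ⟨fun a => by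
        rw [sub_mul, mul_sub, map_sub, map_sub, hcentral, one_mul, mul_one], by
        rw [← map_mul]
        congr 1
        linear_combination (norm := noncomm_ring) hgg⟩)
      (by rw [sub_mul, one_mul, map_sub, map_mul, ← hgg₂, ← map_mul, hg₂' f hfI, sub_self]) hne
    exact hue (h u hu huf)
  obtain ⟨n, hn⟩ := exists_pow_eq_zero_of_toSemisimple_eq_zero hge
  have hpow : ∀ m : ℕ, e - ((1 - g) * e) ^ (m + 1) ∈ I := by
    have h1 : e - (1 - g) * e ∈ I := by
      have : e - (1 - g) * e = g * e := by noncomm_ring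
      rw [this]
      exact hr e g hg
    intro m
    induction m with
    | zero => simpa using h1
    | succ m ih =>
      have : e - ((1 - g) * e) ^ (m + 1 + 1) = (e - ((1 - g) * e) ^ (m + 1)) * e +
          ((1 - g) * e) ^ (m + 1) * (e - (1 - g) * e) := by
        rw [pow_succ _ (m + 1)]
        generalize ((1 - g) * e) ^ (m + 1) = s
        linear_combination (norm := noncomm_ring) -he
      rw [this]
      exact I.add_mem (hr _ _ ih) (hl _ _ h1)
  have := hpow n
  rwa [pow_succ, hn, zero_mul, sub_zero] at this

theorem IsStrictPair.mem_span (F : Type*) {A : Type*} [Field F] [Ring A] [Algebra F A]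
    [FiniteDimensional F A] {e f : A} (h : IsStrictPair e f) :
    e ∈ Submodule.span F {x | ∃ a b, x = a * f * b} ∧
      f ∈ Submodule.span F {x | ∃ a b, x = a * e * b} := by
  refine ⟨mem_span_of_primitiveCentralIdempotentMod F h.1 fun u hu h0 => ?_,
    mem_span_of_primitiveCentralIdempotentMod F h.2.1 fun u hu h0 => ?_⟩ <;>
  rw [toSemisimple_eq_zero_iff] at h0 ⊢
  · exact (h.2.2 u hu).2 h0
  · exact (h.2.2 u hu).1 h0

/-- Two subspaces `e₁Af₁ ⊆ eAf` attached to strict pairs coincide if they agree modulo the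
radical. -/
theorem IsStrictPair.mul_eq_of_le (F : Type*) {A : Type*} [Field F] [Ring A] [Algebra F A]
    [FiniteDimensional F A] {e f e₁ f₁ : A} (h : IsStrictPair e f) (h₁ : IsStrictPair e₁ f₁)
    (hle : ∀ a, ∃ b, e₁ * a * f₁ = e * b * f)
    (hmod : ∀ a, toSemisimple A (e₁ * (e * a * f) * f₁) = toSemisimple A (e * a * f)) :
    e₁ * e = e ∧ f * f₁ = f := by
  have : IsArtinianRing A := IsArtinianRing.of_finite F A
  obtain ⟨heI, hfI⟩ := h.mem_span F
  obtain ⟨heI₁, hfI₁⟩ := h₁.mem_span F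
  obtain ⟨he, hf, -⟩ := h
  obtain ⟨he₁, hf₁, -⟩ := h₁
  have left : ∀ a, e * (e₁ * a * f₁) = e₁ * a * f₁ := fun a => by
    obtain ⟨b, hb⟩ := hle a
    rw [hb]
    linear_combination (norm := noncomm_ring) he * b * f
  have right : ∀ a, (e₁ * a * f₁) * f = e₁ * a * f₁ := fun a => by
    obtain ⟨b, hb⟩ := hle a
    rw [hb]
    linear_combination (norm := noncomm_ring) e * b * hf
  have hee₁ : e * e₁ = e₁ := by
    have : ∀ x ∈ Submodule.span F {x | ∃ a b, x = a * f₁ * b}, e * (e₁ * x) = e₁ * x := by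
      intro x hx
      induction hx using Submodule.span_induction with
      | zero => simp
      | add x y _ _ hx hy => simp only [mul_add, hx, hy]
      | smul r x _ hx => simp only [mul_smul_comm, hx]
      | mem x hx =>
        obtain ⟨a, b, rfl⟩ := hx
        linear_combination (norm := noncomm_ring) left a * b
    simpa only [he₁] using this e₁ heI₁
  have hff₁ : f₁ * f = f₁ := by
    have : ∀ x ∈ Submodule.span F {x | ∃ a b, x = a * e₁ * b}, x * f₁ * f = x * f₁ := by
      intro x hx
      induction hx using Submodule.span_induction with
      | zero => simp
      | add x y _ _ hx hy => simp only [add_mul, hx, hy]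
      | smul r x _ hx => simp only [smul_mul_assoc, hx]
      | mem x hx =>
        obtain ⟨a, b, rfl⟩ := hx
        linear_combination (norm := noncomm_ring) a * right b
    simpa only [hf₁] using this f₁ hfI₁
  have he₁e : toSemisimple A (e₁ * e) = toSemisimple A e := by
    have : ∀ x ∈ Submodule.span F {x | ∃ a b, x = a * f * b},
        toSemisimple A (e₁ * (e * x)) = toSemisimple A (e * x) := by
      intro x hx
      induction hx using Submodule.span_induction with
      | zero => simp
      | add x y _ _ hx hy => simp only [mul_add, map_add, hx, hy]
      | smul r x _ hx =>
        simp only [Algebra.smul_def, ← mul_assoc, ← Algebra.commutes r] at hx ⊢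
        simp only [mul_assoc, map_mul] at hx ⊢
        rw [hx]
      | mem x hx =>
        obtain ⟨a, b, rfl⟩ := hx
        have e1 : e * (a * f * b) = e * a * f * b := by noncomm_ring
        have e2 : e₁ * (e₁ * (e * a * f) * f₁) = e₁ * (e * a * f) * f₁ := by
          linear_combination (norm := noncomm_ring) he₁ * (e * a * f) * f₁
        rw [e1, map_mul, map_mul _ (e * a * f), ← hmod a, ← map_mul, ← map_mul, ← mul_assoc, e2,
          map_mul]
    simpa only [he] using this e heI
  have hff₁' : toSemisimple A (f * f₁) = toSemisimple A f := by
    have : ∀ x ∈ Submodule.span F {x | ∃ a b, x = a * e * b},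
        toSemisimple A (x * f * f₁) = toSemisimple A (x * f) := by
      intro x hx
      induction hx using Submodule.span_induction with
      | zero => simp
      | add x y _ _ hx hy => simp only [add_mul, map_add, hx, hy]
      | smul r x _ hx =>
        simp only [Algebra.smul_def, mul_assoc, map_mul] at hx ⊢
        rw [hx]
      | mem x hx =>
        obtain ⟨a, b, rfl⟩ := hx
        have e1 : a * e * b * f = a * (e * b * f) := by noncomm_ring
        have e2 : (e₁ * (e * b * f) * f₁) * f₁ = e₁ * (e * b * f) * f₁ := by
          linear_combination (norm := noncomm_ring) e₁ * (e * b * f) * hf₁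
        rw [e1, map_mul, map_mul _ a, ← hmod b, ← map_mul, ← map_mul, mul_assoc a, e2, map_mul]
    simpa only [hf] using this f hfI
  constructor
  · refine (sub_eq_zero.1 (eq_zero_of_idempotent (a := e - e₁ * e) ?_ ?_)).symm
    · linear_combination (norm := noncomm_ring) he - hee₁ * e - e₁ * he + e₁ * hee₁ * e + he₁ * e
    · rw [map_sub, he₁e, sub_self]
  · refine (sub_eq_zero.1 (eq_zero_of_idempotent (a := f - f * f₁) ?_ ?_)).symm
    · linear_combination (norm := noncomm_ring) hf - f * hff₁ - hf * f₁ + f * hff₁ * f₁ + f * hf₁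
    · rw [map_sub, hff₁', sub_self]

end Lie

/-- **Theorem.** Let `A` be finite-dimensional over an algebraically closed field of
characteristic `p ≠ 2,3` and let `B` be a Jordan-Lie inner ideal of `L = A⁽ᵏ⁾`.
Then `B` is bar-minimal iff `B = eAf` for a strict orthogonal idempotent pair
`(e, f)` in `A`. -/
theorem barMinimal_iff_eAf (F A : Type*) [Field F] [IsAlgClosed F] (p : ℕ)
    [CharP F p] (hp2 : p ≠ 2) (hp3 : p ≠ 3) [Ring A] [Algebra F A]
    [FiniteDimensional F A] (k : ℕ) (B : Submodule F A)
    (hJLie : IsJordanLie (derivedSeries F A k) B) :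
    (∀ B₀ : Submodule F A, IsInnerIdeal (derivedSeries F A k) B₀ → B₀ ≤ B →
        (∀ x ∈ B, ∃ y ∈ B₀, x - y ∈ (radical : Submodule F A)) → B₀ = B) ↔
      ∃ e f : A, IsStrictPair e f ∧ e * f = 0 ∧ f * e = 0 ∧
        ∀ b : A, b ∈ B ↔ ∃ x : A, b = e * x * f := by
  have : IsArtinianRing A := IsArtinianRing.of_finite F A
  have h2 : (2 : F) ≠ 0 := fun h => by
    have h' : ((2 : ℕ) : F) = 0 := by exact_mod_cast h
    rcases (Nat.dvd_prime Nat.prime_two).1 ((CharP.cast_eq_zero_iff F p 2).1 h') with h1 | h1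
    · exact CharP.char_ne_one F p h1
    · exact hp2 h1
  constructor
  · intro hmin
    obtain ⟨e, f, hs, hef, hfe, hmem, hmod⟩ := hJLie.exists_strictPair h2
    refine ⟨e, f, hs, hef, hfe, ?_⟩
    let B₀ : Submodule F A :=
      LinearMap.range (LinearMap.mulLeft F e ∘ₗ LinearMap.mulRight F f)
    have hB₀ : ∀ b, b ∈ B₀ ↔ ∃ x, b = e * x * f := fun b => by
      simp only [B₀, LinearMap.mem_range, LinearMap.comp_apply, LinearMap.mulRight_apply,
        LinearMap.mulLeft_apply, mul_assoc, eq_comm]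
    have hle : B₀ ≤ B := fun b hb => by
      obtain ⟨x, rfl⟩ := (hB₀ b).1 hb
      exact hmem x
    suffices h : B₀ = B from h ▸ hB₀
    refine hmin B₀ ⟨hle.trans hJLie.1.1, ?_⟩ hle ?_
    · intro b hb b' hb' x _
      obtain ⟨a, rfl⟩ := (hB₀ b).1 hb
      obtain ⟨a', rfl⟩ := (hB₀ b').1 hb'
      refine (hB₀ _).2 ⟨-(a * f * x * e * a' + a' * f * x * e * a), ?_⟩
      simp only [Ring.lie_def]
      linear_combination (norm := noncomm_ring)
        e * a * hfe * a' * f * x + x * e * a' * hfe * a * f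
    · intro x hx
      exact ⟨e * x * f, (hB₀ _).2 ⟨x, rfl⟩, by rw [mem_radical_iff, map_sub, hmod x hx, sub_self]⟩
  · rintro ⟨e, f, hs, hef, hfe, hB⟩ B₀ hinner hle hcover
    have hJLie₀ : IsJordanLie (derivedSeries F A k) B₀ :=
      ⟨hinner, fun b hb b' hb' => hJLie.2 b (hle hb) b' (hle hb')⟩
    obtain ⟨e₁, f₁, hs₁, -, -, hmem, hmod⟩ := hJLie₀.exists_strictPair h2
    obtain ⟨he, hf⟩ := hs.mul_eq_of_le F hs₁ (fun a => (hB _).1 (hle (hmem a))) fun a => by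
      obtain ⟨y, hy, hxy⟩ := hcover _ ((hB _).2 ⟨a, rfl⟩)
      rw [mem_radical_iff, map_sub, sub_eq_zero] at hxy
      rw [map_mul, map_mul, hxy, ← map_mul, ← map_mul, hmod y hy]
    refine le_antisymm hle fun b hb => ?_
    obtain ⟨a, rfl⟩ := (hB b).1 hb
    have : e * a * f = e₁ * (e * a * f) * f₁ := by
      linear_combination (norm := noncomm_ring) -he * a * f - e₁ * e * a * hf
    rw [this]
    exact hmem _

end Paper
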